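/- Let H and K be complex Hilbert spaces, let E be a TRO in B(K,H), and let Ω be a nonempty compact Hausdorff space. Consider V = C(Ω, E), the continuous E-valued functions on Ω, with pointwise operations (f g* h)(ω) = f(ω) g(ω)* h(ω). If every TRO-derivation of V is an inner TRO-derivation, then every TRO-derivation of E is an inner TRO-derivation. -/

import Mathlib

open ContinuousLinearMap

/-- Let `E ⊆ B(K,H)` be a TRO and `Ω` a nonempty compact Hausdorff space, and let
`V = C(Ω, E)` with the pointwise ternary product.  If every TRO-derivation of `V`
is an inner TRO-derivation, then every TRO-derivation of `E` is an inner
TRO-derivation. -/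
theorem stmt_19 {H K : Type*}
    [NormedAddCommGroup H] [InnerProductSpace ℂ H] [CompleteSpace H]
    [NormedAddCommGroup K] [InnerProductSpace ℂ K] [CompleteSpace K]
    (E : Submodule ℂ (K →L[ℂ] H)) (hEclosed : IsClosed (E : Set (K →L[ℂ] H)))
    (hEtro : ∀ x ∈ E, ∀ y ∈ E, ∀ z ∈ E, x ∘L (adjoint y) ∘L z ∈ E)
    (Ω : Type*) [TopologicalSpace Ω] [CompactSpace Ω] [T2Space Ω] [Nonempty Ω]
    (hV : ∀ DV : C(Ω, E) →L[ℂ] C(Ω, E),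
      (∀ f g h w : C(Ω, E),
        (∀ ω, ((w ω : E) : K →L[ℂ] H) =
          ((f ω : E) : K →L[ℂ] H) ∘L adjoint ((g ω : E) : K →L[ℂ] H)
            ∘L ((h ω : E) : K →L[ℂ] H)) →
        ∀ ω, ((DV w ω : E) : K →L[ℂ] H) =
          ((DV f ω : E) : K →L[ℂ] H) ∘L adjoint ((g ω : E) : K →L[ℂ] H)
              ∘L ((h ω : E) : K →L[ℂ] H)
            + ((f ω : E) : K →L[ℂ] H) ∘L adjoint ((DV g ω : E) : K →L[ℂ] H)
              ∘L ((h ω : E) : K →L[ℂ] H)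
            + ((f ω : E) : K →L[ℂ] H) ∘L adjoint ((g ω : E) : K →L[ℂ] H)
              ∘L ((DV h ω : E) : K →L[ℂ] H)) →
      ∃ (n m : ℕ) (a b : Fin n → C(Ω, E)) (c d : Fin m → C(Ω, E)),
        ∀ (f : C(Ω, E)) (ω : Ω), ((DV f ω : E) : K →L[ℂ] H) =
          (∑ i, (((a i ω : E) : K →L[ℂ] H) ∘L adjoint ((b i ω : E) : K →L[ℂ] H)
              - ((b i ω : E) : K →L[ℂ] H) ∘L adjoint ((a i ω : E) : K →L[ℂ] H)))
            ∘L ((f ω : E) : K →L[ℂ] H)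
          + ((f ω : E) : K →L[ℂ] H) ∘L
            (∑ j, (adjoint ((c j ω : E) : K →L[ℂ] H) ∘L ((d j ω : E) : K →L[ℂ] H)
              - adjoint ((d j ω : E) : K →L[ℂ] H) ∘L ((c j ω : E) : K →L[ℂ] H)))) :
    ∀ DE : E →L[ℂ] E,
      (∀ x y z w : E,
        (w : K →L[ℂ] H) = (x : K →L[ℂ] H) ∘L adjoint (y : K →L[ℂ] H) ∘L (z : K →L[ℂ] H) →
        (DE w : K →L[ℂ] H) =
          (DE x : K →L[ℂ] H) ∘L adjoint (y : K →L[ℂ] H) ∘L (z : K →L[ℂ] H)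
            + (x : K →L[ℂ] H) ∘L adjoint (DE y : K →L[ℂ] H) ∘L (z : K →L[ℂ] H)
            + (x : K →L[ℂ] H) ∘L adjoint (y : K →L[ℂ] H) ∘L (DE z : K →L[ℂ] H)) →
      ∃ (n m : ℕ) (a b : Fin n → E) (c d : Fin m → E),
        ∀ x : E, (DE x : K →L[ℂ] H) =
          (∑ i, ((a i : K →L[ℂ] H) ∘L adjoint (b i : K →L[ℂ] H)
              - (b i : K →L[ℂ] H) ∘L adjoint (a i : K →L[ℂ] H))) ∘L (x : K →L[ℂ] H)
          + (x : K →L[ℂ] H) ∘L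
            (∑ j, (adjoint (c j : K →L[ℂ] H) ∘L (d j : K →L[ℂ] H)
              - adjoint (d j : K →L[ℂ] H) ∘L (c j : K →L[ℂ] H))) := by
  intro DE hDE
  obtain ⟨ω⟩ := ‹Nonempty Ω›
  obtain ⟨n, m, a, b, c, d, h⟩ := hV (DE.compLeftContinuous ℂ Ω)
    fun f g h w hw ω => hDE (f ω) (g ω) (h ω) (w ω) (hw ω)
  exact ⟨n, m, fun i => a i ω, fun i => b i ω, fun j => c j ω, fun j => d j ω,
    fun x => h (ContinuousMap.const Ω x) ω⟩
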